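/- arXiv:1503.00528 — 5 statements merged into one kernel-verified Lean document; each statement's English description precedes it below -/
import Mathlib

section
/- Let d ≥ 2 and let k satisfy 1 ≤ k ≤ d. Let W ∈ Matrix (Fin d × Fin d) (Fin d × Fin d) ℂ be Hermitian (Wᴴ = W), and let Λ be a ℂ-linear map on Matrix (Fin d) (Fin d) ℂ such that (1 ⊗ Λ)W is positive semidefinite. Suppose the image under the Hilbert–Schmidt adjoint Λ† of the set of rank-k orthogonal projectors on ℂ^d equals the set of rank-1 orthogonal projectors on ℂ^d. Then for all unit vectors ψ, φ ∈ ℂ^d, 0 ≤ Re(trace(W · (|ψ⟩⟨ψ| ⊗ₖ |φ⟩⟨φ|))); in particular, if moreover W is not positive semidefinite, W is an entanglement witness. -/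
open Matrix Kronecker ComplexOrder

/-- The map `1 ⊗ Λ` acting on `Matrix (Fin d × Fin d) (Fin d × Fin d) ℂ`, defined
entrywise by `((1 ⊗ Λ) M) ((i,k),(j,l)) = (Λ M⁽ⁱʲ⁾) (k,l)` where
`M⁽ⁱʲ⁾ (k,l) = M ((i,k),(j,l))`. -/
noncomputable def oneTensor {d : ℕ}
    (Λ : Matrix (Fin d) (Fin d) ℂ →ₗ[ℂ] Matrix (Fin d) (Fin d) ℂ)
    (M : Matrix (Fin d × Fin d) (Fin d × Fin d) ℂ) :
    Matrix (Fin d × Fin d) (Fin d × Fin d) ℂ :=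
  Matrix.of fun p q => Λ (Matrix.of fun k l => M (p.1, k) (q.1, l)) p.2 q.2

/-- An orthogonal projector of rank `c` (here `c` is the value of the trace). -/
def IsOrthProj {d : ℕ} (P : Matrix (Fin d) (Fin d) ℂ) (c : ℂ) : Prop :=
  P * P = P ∧ Pᴴ = P ∧ P.trace = c

theorem trace_mul_kron_blocks {d : ℕ} (M : Matrix (Fin d × Fin d) (Fin d × Fin d) ℂ)
    (A B : Matrix (Fin d) (Fin d) ℂ) :
    Matrix.trace (M * (A ⊗ₖ B)) =
      ∑ i, ∑ j, A j i * Matrix.trace ((Matrix.of fun k l => M (i, k) (j, l)) * B) := by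
  simp only [Matrix.trace, Matrix.diag, Matrix.mul_apply, Fintype.sum_prod_type,
    Matrix.kroneckerMap_apply, Matrix.of_apply, Finset.mul_sum]
  refine Finset.sum_congr rfl fun i _ => ?_
  rw [Finset.sum_comm]
  refine Finset.sum_congr rfl fun j _ => Finset.sum_congr rfl fun a _ =>
    Finset.sum_congr rfl fun b _ => ?_
  ring

theorem isOrthProj_vec {d : ℕ} (ψ : Fin d → ℂ) (h : star ψ ⬝ᵥ ψ = 1) :
    IsOrthProj (vecMulVec ψ (star ψ)) 1 := by
  refine ⟨?_, ?_, ?_⟩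
  · rw [Matrix.vecMulVec_mul_vecMulVec, h, one_smul]
  · rw [Matrix.conjTranspose_vecMulVec, star_star]
  · rw [Matrix.trace_vecMulVec, dotProduct_comm, h]

/-- If `W` is Hermitian, `(1 ⊗ Λ) W` is positive semidefinite, and the Hilbert–Schmidt
adjoint `Λ†` maps the set of rank-`k` orthogonal projectors surjectively onto the set of
rank-one orthogonal projectors, then `W` has nonnegative expectation value on every
product state; in particular if `W` is not positive semidefinite, it is an entanglement
witness. -/
theorem entanglement_witness_from_nonpositive_map (d k : ℕ) (hd : 2 ≤ d)
    (hk1 : 1 ≤ k) (hkd : k ≤ d)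
    (W : Matrix (Fin d × Fin d) (Fin d × Fin d) ℂ) (hW : Wᴴ = W)
    (Λ Λdag : Matrix (Fin d) (Fin d) ℂ →ₗ[ℂ] Matrix (Fin d) (Fin d) ℂ)
    (hadj : ∀ A B : Matrix (Fin d) (Fin d) ℂ,
      Matrix.trace (A * Λ B) = Matrix.trace (B * Λdag A))
    (hpos : (oneTensor Λ W).PosSemidef)
    (hsurj : (fun P => Λdag P) '' {P | IsOrthProj P (k : ℂ)} = {Q | IsOrthProj Q 1}) :
    (∀ ψ φ : Fin d → ℂ, star ψ ⬝ᵥ ψ = 1 → star φ ⬝ᵥ φ = 1 →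
      0 ≤ (Matrix.trace (W * (vecMulVec ψ (star ψ) ⊗ₖ vecMulVec φ (star φ)))).re) ∧
    (¬ W.PosSemidef →
      (Wᴴ = W ∧ ¬ W.PosSemidef ∧
        ∀ ψ φ : Fin d → ℂ, star ψ ⬝ᵥ ψ = 1 → star φ ⬝ᵥ φ = 1 →
          0 ≤ (Matrix.trace (W * (vecMulVec ψ (star ψ) ⊗ₖ vecMulVec φ (star φ)))).re)) := by
  have key : ∀ ψ φ : Fin d → ℂ, star ψ ⬝ᵥ ψ = 1 → star φ ⬝ᵥ φ = 1 →
      0 ≤ (Matrix.trace (W * (vecMulVec ψ (star ψ) ⊗ₖ vecMulVec φ (star φ)))).re := by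
    intro ψ φ hψ hφ
    have h1 : vecMulVec φ (star φ) ∈ {Q : Matrix (Fin d) (Fin d) ℂ | IsOrthProj Q 1} :=
      isOrthProj_vec φ hφ
    rw [← hsurj] at h1
    obtain ⟨P, ⟨hP1, hP2, -⟩, hP⟩ := h1
    obtain ⟨hA1, hA2, -⟩ := isOrthProj_vec ψ hψ
    generalize vecMulVec ψ (star ψ) = A at *
    have e : Matrix.trace (W * (A ⊗ₖ vecMulVec φ (star φ)))
        = Matrix.trace (oneTensor Λ W * (A ⊗ₖ P)) := by
      rw [trace_mul_kron_blocks, trace_mul_kron_blocks]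
      refine Finset.sum_congr rfl fun i _ => Finset.sum_congr rfl fun j _ => ?_
      rw [← hP, ← hadj, Matrix.trace_mul_comm]
      rfl
    have hC1 : (A ⊗ₖ P) * (A ⊗ₖ P) = A ⊗ₖ P := by
      rw [← Matrix.mul_kronecker_mul, hA1, hP1]
    have hC2 : (A ⊗ₖ P)ᴴ = A ⊗ₖ P := by
      rw [Matrix.conjTranspose_kronecker, hA2, hP2]
    have h2 := (hpos.mul_mul_conjTranspose_same (A ⊗ₖ P)).trace_nonneg
    rw [hC2, Matrix.trace_mul_comm, ← Matrix.mul_assoc, hC1, Matrix.trace_mul_comm] at h2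
    rw [e]
    exact (Complex.le_def.1 h2).1
  exact ⟨key, fun h => ⟨hW, h, key⟩⟩
end

section
/- Let d ≥ 2 and let X ∈ Matrix (Fin d) (Fin d) ℂ be Hermitian. If R⁻¹(X) is positive semidefinite, then X is positive semidefinite. -/
open Matrix ComplexOrder

/-- The inverse reduction map `R⁻¹(A) = (trace A / (d-1)) • 1 - A`. -/
noncomputable def Rinv (d : ℕ) (A : Matrix (Fin d) (Fin d) ℂ) : Matrix (Fin d) (Fin d) ℂ :=
  (A.trace / ((d : ℂ) - 1)) • (1 : Matrix (Fin d) (Fin d) ℂ) - A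

lemma trace_smul_one_sub_posSemidef {d : ℕ} {Y : Matrix (Fin d) (Fin d) ℂ}
    (h : Y.PosSemidef) : (Y.trace • (1 : Matrix (Fin d) (Fin d) ℂ) - Y).PosSemidef := by
  have hY := h.1
  have key : Y.trace • (1 : Matrix (Fin d) (Fin d) ℂ) - Y =
      (hY.eigenvectorUnitary : Matrix (Fin d) (Fin d) ℂ) *
        diagonal (fun i => Y.trace - (hY.eigenvalues i : ℂ)) *
        (hY.eigenvectorUnitary : Matrix (Fin d) (Fin d) ℂ)ᴴ := by
    have h1 : diagonal (fun i => Y.trace - (hY.eigenvalues i : ℂ)) =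
        Y.trace • (1 : Matrix (Fin d) (Fin d) ℂ) -
          diagonal (RCLike.ofReal ∘ hY.eigenvalues) := by
      rw [smul_one_eq_diagonal, diagonal_sub]
      rfl
    have h2 : (hY.eigenvectorUnitary : Matrix (Fin d) (Fin d) ℂ) *
        (hY.eigenvectorUnitary : Matrix (Fin d) (Fin d) ℂ)ᴴ = 1 :=
      Unitary.coe_mul_star_self _
    have h3 := hY.spectral_theorem
    rw [Unitary.conjStarAlgAut_apply] at h3
    rw [h1, mul_sub, sub_mul, mul_smul_comm, smul_mul_assoc, mul_one, h2]
    congr 1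
  rw [key]
  refine PosSemidef.mul_mul_conjTranspose_same (PosSemidef.diagonal fun i => ?_) _
  have h4 := hY.trace_eq_sum_eigenvalues
  have h5 : hY.eigenvalues i ≤ ∑ j, hY.eigenvalues j :=
    Finset.single_le_sum (fun j _ => h.eigenvalues_nonneg j) (Finset.mem_univ i)
  change (0 : ℂ) ≤ Y.trace - (hY.eigenvalues i : ℂ)
  rw [sub_nonneg, h4]
  have h6 : ((hY.eigenvalues i : ℝ) : ℂ) ≤ ((∑ j, hY.eigenvalues j : ℝ) : ℂ) := by
    exact_mod_cast h5
  simpa using h6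

/-- If `X` is Hermitian and `R⁻¹(X)` is positive semidefinite, then `X` is positive
semidefinite. -/
theorem posSemidef_of_inverse_reduction_posSemidef (d : ℕ) (hd : 2 ≤ d)
    (X : Matrix (Fin d) (Fin d) ℂ) (hX : Xᴴ = X)
    (h : (Rinv d X).PosSemidef) : X.PosSemidef := by
  have hd1 : (d : ℂ) - 1 ≠ 0 := by
    rw [sub_ne_zero]
    exact_mod_cast (by omega : d ≠ 1)
  have ht : (Rinv d X).trace = X.trace / ((d : ℂ) - 1) := by
    simp only [Rinv, trace_sub, trace_smul, trace_one, Fintype.card_fin, smul_eq_mul]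
    field_simp
    ring
  have := trace_smul_one_sub_posSemidef h
  rw [ht] at this
  simpa [Rinv] using this
end

section
/- Let d ≥ 3 and let J ∈ Matrix (Fin d) (Fin d) ℂ be the matrix all of whose entries equal 1. Then J is positive semidefinite, but R⁻¹(J) = (d/(d−1)) • 1 − J is not positive semidefinite (it has the negative eigenvalue d(2−d)/(d−1)); hence R⁻¹ is not a positive map. -/
open Matrix ComplexOrder

/-- For `d ≥ 3`, the all-ones matrix `J` is positive semidefinite, but
`R⁻¹(J) = (d/(d-1)) • 1 - J` is not: it has the negative eigenvalue `d(2-d)/(d-1)`.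
Hence `R⁻¹` is not a positive map. -/
theorem inverse_reduction_not_positive (d : ℕ) (hd : 3 ≤ d)
    (J : Matrix (Fin d) (Fin d) ℂ) (hJ : J = Matrix.of fun _ _ => (1 : ℂ)) :
    J.PosSemidef ∧
    Rinv d J = ((d : ℂ) / ((d : ℂ) - 1)) • (1 : Matrix (Fin d) (Fin d) ℂ) - J ∧
    (∃ v : Fin d → ℂ, v ≠ 0 ∧
      (Rinv d J).mulVec v = (((d : ℂ) * (2 - (d : ℂ))) / ((d : ℂ) - 1)) • v ∧
      (((d : ℝ) * (2 - (d : ℝ))) / ((d : ℝ) - 1)) < 0) ∧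
    ¬ (Rinv d J).PosSemidef ∧
    ¬ (∀ A : Matrix (Fin d) (Fin d) ℂ, A.PosSemidef → (Rinv d A).PosSemidef) := by
  have hdR : (3 : ℝ) ≤ (d : ℝ) := by exact_mod_cast hd
  have hd1 : ((d : ℂ) - 1) ≠ 0 := by
    intro h
    have h2 : (d : ℂ) = ((1 : ℕ) : ℂ) := by push_cast; linear_combination h
    have h3 : d = 1 := by exact_mod_cast h2
    omega
  have hneg : (((d : ℝ) * (2 - (d : ℝ))) / ((d : ℝ) - 1)) < 0 := by
    apply div_neg_of_neg_of_pos
    · nlinarith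
    · linarith
  have hpsd : J.PosSemidef := by
    have h := Matrix.posSemidef_vecMulVec_self_star (fun _ : Fin d => (1 : ℂ))
    have e : J = Matrix.vecMulVec (fun _ : Fin d => (1 : ℂ)) (star (fun _ : Fin d => (1 : ℂ))) := by
      subst hJ
      ext i j
      simp [Matrix.vecMulVec_apply]
    rw [e]
    exact h
  have hR : Rinv d J = ((d : ℂ) / ((d : ℂ) - 1)) • (1 : Matrix (Fin d) (Fin d) ℂ) - J := by
    have ht : J.trace = (d : ℂ) := by
      subst hJ
      simp [Matrix.trace]
    rw [Rinv, ht]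
  have hv : (Rinv d J).mulVec (fun _ => (1 : ℂ)) =
      (((d : ℂ) * (2 - (d : ℂ))) / ((d : ℂ) - 1)) • (fun _ => (1 : ℂ)) := by
    have hJv : J.mulVec (fun _ => (1 : ℂ)) = fun _ => (d : ℂ) := by
      subst hJ
      ext i
      simp [Matrix.mulVec, dotProduct]
    rw [hR, Matrix.sub_mulVec, Matrix.smul_mulVec, Matrix.one_mulVec, hJv]
    ext i
    simp only [Pi.sub_apply, Pi.smul_apply, smul_eq_mul, mul_one]
    field_simp
    ring
  have hnot : ¬ (Rinv d J).PosSemidef := by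
    intro h
    have h1 := h.dotProduct_mulVec_nonneg (fun _ => (1 : ℂ))
    rw [hv] at h1
    have e : star (fun _ : Fin d => (1 : ℂ)) ⬝ᵥ
        ((((d : ℂ) * (2 - (d : ℂ))) / ((d : ℂ) - 1)) • (fun _ : Fin d => (1 : ℂ))) =
        (((d : ℝ) * ((((d : ℝ) * (2 - (d : ℝ))) / ((d : ℝ) - 1))) : ℝ) : ℂ) := by
      simp [dotProduct]
    rw [e] at h1
    have h2 : (0 : ℝ) ≤ (d : ℝ) * ((((d : ℝ) * (2 - (d : ℝ))) / ((d : ℝ) - 1))) := by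
      exact_mod_cast h1
    nlinarith
  refine ⟨hpsd, hR, ⟨fun _ => 1, ?_, hv, hneg⟩, hnot, fun h => hnot (h J hpsd)⟩
  intro h
  have := congrFun h ⟨0, by omega⟩
  simp at this
end

section
/- Let W_Ch ∈ Matrix (Fin 3 × Fin 3) (Fin 3 × Fin 3) ℂ be defined by W_Ch((i,k),(j,l)) = 1 if i = j, k = l, i ≠ k; W_Ch((i,k),(j,l)) = −1 if i = k, j = l, i ≠ j; and 0 otherwise. Then W_Ch is block positive: for all unit vectors ψ, φ ∈ ℂ³, 0 ≤ Re(trace(W_Ch · (|ψ⟩⟨ψ| ⊗ₖ |φ⟩⟨φ|))). Together with W_Ch not being positive semidefinite, W_Ch is an entanglement witness. -/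
open Matrix Kronecker ComplexOrder

/-- The Choi-type entanglement witness. -/
def WCh : Matrix (Fin 3 × Fin 3) (Fin 3 × Fin 3) ℂ :=
  Matrix.of fun p q =>
    if p.1 = q.1 ∧ p.2 = q.2 ∧ p.1 ≠ p.2 then 1
    else if p.1 = p.2 ∧ q.1 = q.2 ∧ p.1 ≠ q.1 then -1 else 0

/-- `W_Ch` is block positive (nonnegative on all product states), Hermitian, and not
positive semidefinite: it is an entanglement witness. -/
theorem choi_witness_is_entanglement_witness :
    (∀ ψ φ : Fin 3 → ℂ, star ψ ⬝ᵥ ψ = 1 → star φ ⬝ᵥ φ = 1 →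
      0 ≤ (Matrix.trace (WCh * (vecMulVec ψ (star ψ) ⊗ₖ vecMulVec φ (star φ)))).re) ∧
    WChᴴ = WCh ∧ ¬ WCh.PosSemidef := by
  refine ⟨?_, ?_, ?_⟩
  · intro ψ φ _ _
    have key : (Matrix.trace (WCh * (vecMulVec ψ (star ψ) ⊗ₖ vecMulVec φ (star φ)))).re
        = Complex.normSq (ψ 0 * star (φ 1) - ψ 1 * star (φ 0))
        + Complex.normSq (ψ 0 * star (φ 2) - ψ 2 * star (φ 0))
        + Complex.normSq (ψ 1 * star (φ 2) - ψ 2 * star (φ 1)) := by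
      simp [Matrix.trace, Matrix.mul_apply, WCh, Fintype.sum_prod_type, Fin.sum_univ_three,
        vecMulVec_apply, Complex.normSq_apply]
      ring
    rw [key]
    have h := Complex.normSq_nonneg
    exact add_nonneg (add_nonneg (h _) (h _)) (h _)
  · ext ⟨a, b⟩ ⟨c, d⟩
    fin_cases a <;> fin_cases b <;> fin_cases c <;> fin_cases d <;>
      simp [WCh, Matrix.conjTranspose_apply]
  · intro h
    have h2 := h.dotProduct_mulVec_nonneg (fun p => if p.1 = p.2 then 1 else 0)
    simp [WCh, dotProduct, mulVec, Fintype.sum_prod_type, Fin.sum_univ_three] at h2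
    norm_num [Complex.le_def] at h2
end

section
/- Let M ∈ Matrix (Fin n) (Fin n) ℂ be Hermitian with eigenvalues (counted with multiplicity) sorted increasingly as λ₁ ≤ λ₂ ≤ … ≤ λₙ, and let P ∈ Matrix (Fin n) (Fin n) ℂ be an orthogonal projector with trace P = k (so P·P = P, Pᴴ = P). Then λ₁ + λ₂ + … + λ_k ≤ Re(trace(M · P)). -/
open Matrix

theorem aux_sum (n k : ℕ) (μ w : Fin n → ℝ) (hsort : Monotone μ)
    (h0 : ∀ i, 0 ≤ w i) (h1 : ∀ i, w i ≤ 1) (hs : ∑ i, w i = k) :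
    ∑ i ∈ Finset.univ.filter (fun i : Fin n => (i : ℕ) < k), μ i ≤ ∑ i, μ i * w i := by
  have hkn : k ≤ n := by
    have : (k : ℝ) ≤ n := by
      rw [← hs]
      calc ∑ i, w i ≤ ∑ i : Fin n, (1 : ℝ) := Finset.sum_le_sum fun i _ => h1 i
        _ = n := by simp
    exact_mod_cast this
  rcases Nat.eq_zero_or_pos n with hn | hn
  · subst hn
    simp
  have hk : k - 1 < n := by omega
  set c := μ ⟨k - 1, hk⟩ with hc
  have hcard : ∑ i : Fin n, (if (i : ℕ) < k then (1 : ℝ) else 0) = k := by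
    rw [Fin.sum_univ_eq_sum_range (fun i => if i < k then (1 : ℝ) else 0) n,
      ← Finset.sum_filter]
    have : (Finset.range n).filter (fun i => i < k) = Finset.range k := by
      ext i
      simp
      omega
    rw [this]
    simp
  have key : 0 ≤ ∑ i : Fin n, (μ i - c) * (w i - if (i : ℕ) < k then (1 : ℝ) else 0) := by
    apply Finset.sum_nonneg
    intro i _
    split_ifs with h
    · have : μ i ≤ c := hsort (by rw [Fin.le_def]; simp; omega)
      nlinarith [h1 i]
    · have : c ≤ μ i := hsort (by rw [Fin.le_def]; simp; omega)
      nlinarith [h0 i]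
  have e : ∑ i : Fin n, (μ i - c) * (w i - if (i : ℕ) < k then (1 : ℝ) else 0)
      = ∑ i, μ i * w i - ∑ i : Fin n, (if (i : ℕ) < k then μ i else 0)
        - c * (∑ i, w i - ∑ i : Fin n, (if (i : ℕ) < k then (1 : ℝ) else 0)) := by
    rw [← Finset.sum_sub_distrib, ← Finset.sum_sub_distrib, Finset.mul_sum,
      ← Finset.sum_sub_distrib]
    apply Finset.sum_congr rfl
    intro i _
    split_ifs <;> ring
  rw [e, hs, hcard] at key
  rw [Finset.sum_filter]
  linarith

theorem aux_diag (n : ℕ) (Q : Matrix (Fin n) (Fin n) ℂ) (hproj : Q * Q = Q) (hherm : Qᴴ = Q)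
    (i : Fin n) : 0 ≤ (Q i i).re ∧ (Q i i).re ≤ 1 := by
  have h : (Q i i).re = ∑ j, Complex.normSq (Q i j) := by
    have h1 : (Q * Qᴴ) i i = Q i i := by rw [hherm, hproj]
    rw [← h1, Matrix.mul_apply, Complex.re_sum]
    apply Finset.sum_congr rfl
    intro j _
    rw [Matrix.conjTranspose_apply, Complex.star_def, Complex.mul_conj, Complex.ofReal_re]
  have h2 : Complex.normSq (Q i i) ≤ (Q i i).re := by
    rw [h]
    exact Finset.single_le_sum (f := fun j => Complex.normSq (Q i j))
      (fun j _ => Complex.normSq_nonneg _) (Finset.mem_univ i)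
  rw [Complex.normSq_apply] at h2
  constructor
  · nlinarith [mul_self_nonneg (Q i i).re, mul_self_nonneg (Q i i).im]
  · nlinarith [mul_self_nonneg (Q i i).re, mul_self_nonneg (Q i i).im]

/-- Ky Fan-type bound: for a Hermitian matrix `M` with eigenvalues sorted increasingly
as `μ`, and an orthogonal projector `P` of rank `k`, the sum of the `k` smallest
eigenvalues of `M` is at most `Re (trace (M * P))`. -/
theorem sum_smallest_eigenvalues_le_trace_mul_projector (n k : ℕ)
    (M : Matrix (Fin n) (Fin n) ℂ) (hM : M.IsHermitian)
    (μ : Fin n → ℝ) (hsort : Monotone μ)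
    (hperm : ∃ σ : Equiv.Perm (Fin n), ∀ i, μ i = hM.eigenvalues (σ i))
    (P : Matrix (Fin n) (Fin n) ℂ)
    (hproj : P * P = P) (hherm : Pᴴ = P) (htr : P.trace = (k : ℂ)) :
    ∑ i ∈ Finset.univ.filter (fun i : Fin n => (i : ℕ) < k), μ i ≤
      (Matrix.trace (M * P)).re := by
  obtain ⟨σ, hσ⟩ := hperm
  obtain ⟨U, D, hU, hU', hD, hMU⟩ : ∃ U D : Matrix (Fin n) (Fin n) ℂ, U * Uᴴ = 1 ∧ Uᴴ * U = 1 ∧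
      D = diagonal (fun i => (hM.eigenvalues i : ℂ)) ∧ M = U * D * Uᴴ := by
    refine ⟨hM.eigenvectorUnitary, _, ?_, ?_, rfl, ?_⟩
    · exact Unitary.coe_mul_star_self hM.eigenvectorUnitary
    · exact Unitary.coe_star_mul_self hM.eigenvectorUnitary
    · exact hM.spectral_theorem
  set Q := Uᴴ * P * U with hQ
  have hQh : Qᴴ = Q := by
    simp [hQ, Matrix.conjTranspose_mul, hherm, Matrix.mul_assoc]
  have hQQ : Q * Q = Q := by
    calc Q * Q = Uᴴ * P * (U * Uᴴ) * P * U := by simp only [hQ, Matrix.mul_assoc]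
      _ = Uᴴ * (P * P) * U := by rw [hU]; simp only [Matrix.mul_assoc, Matrix.one_mul]
      _ = Q := by rw [hproj]
  have hQt : Q.trace = k := by
    rw [hQ, Matrix.trace_mul_comm, ← Matrix.mul_assoc, hU, Matrix.one_mul, htr]
  have hMP : (M * P).trace = (D * Q).trace := by
    rw [hMU, Matrix.mul_assoc, Matrix.mul_assoc, Matrix.trace_mul_comm, hQ]
    simp only [Matrix.mul_assoc]
  have hre : (M * P).trace.re = ∑ i, μ i * (Q (σ i) (σ i)).re := by
    rw [hMP, hD, Matrix.trace, Complex.re_sum, ← Equiv.sum_comp σ]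
    apply Finset.sum_congr rfl
    intro i _
    rw [Matrix.diag_apply, Matrix.diagonal_mul, Complex.re_ofReal_mul, hσ]
  rw [hre]
  apply aux_sum n k μ _ hsort (fun i => (aux_diag n Q hQQ hQh _).1)
    (fun i => (aux_diag n Q hQQ hQh _).2)
  rw [Equiv.sum_comp σ (fun i => (Q i i).re), ← Complex.re_sum]
  have := congrArg Complex.re hQt
  simpa [Matrix.trace] using this
end
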